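/- Every even, unimodular, negative definite lattice of rank 8 is isometric to E8(−1). -/

import Mathlib

open Matrix

/-- The Gram (Coxeter) matrix of the root lattice `E₈`. -/
def E8M : Matrix (Fin 8) (Fin 8) ℤ :=
  !![2, 0, -1, 0, 0, 0, 0, 0;
     0, 2, 0, -1, 0, 0, 0, 0;
     -1, 0, 2, -1, 0, 0, 0, 0;
     0, -1, -1, 2, -1, 0, 0, 0;
     0, 0, 0, -1, 2, -1, 0, 0;
     0, 0, 0, 0, -1, 2, -1, 0;
     0, 0, 0, 0, 0, -1, 2, -1;
     0, 0, 0, 0, 0, 0, -1, 2]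

/-- Two integral Gram matrices are congruent if an invertible integral change of basis carries the
first to the second. The index types may differ. -/
def GramCongr {ι κ : Type*} [Fintype ι] [Fintype κ] [DecidableEq ι] [DecidableEq κ]
    (S : Matrix ι ι ℤ) (T : Matrix κ κ ℤ) : Prop :=
  ∃ (U : Matrix ι κ ℤ) (V : Matrix κ ι ℤ), U * V = 1 ∧ V * U = 1 ∧ U.transpose * S * U = T

/-- Positive definiteness of an integral matrix, tested on integral vectors. -/
def GramPos {ι : Type*} [Fintype ι] (S : Matrix ι ι ℤ) : Prop :=
  ∀ x : ι → ℤ, x ≠ 0 → 0 < x ⬝ᵥ S.mulVec x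

/-- The quadratic form attached to the matrix takes only even values. -/
def GramEven {ι : Type*} [Fintype ι] (S : Matrix ι ι ℤ) : Prop :=
  ∀ x : ι → ℤ, Even (x ⬝ᵥ S.mulVec x)

theorem dotProduct_congr_mulVec {ι κ : Type*} [Fintype ι] [Fintype κ]
    (U : Matrix ι κ ℤ) (S : Matrix ι ι ℤ) (x y : κ → ℤ) :
    x ⬝ᵥ (U.transpose * S * U).mulVec y = U.mulVec x ⬝ᵥ S.mulVec (U.mulVec y) := by
  rw [← Matrix.mulVec_mulVec, ← Matrix.mulVec_mulVec, Matrix.dotProduct_mulVec,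
    Matrix.vecMul_transpose]

section Congruence

variable {ι κ μ : Type*} [Fintype ι] [Fintype κ] [Fintype μ]
  [DecidableEq ι] [DecidableEq κ] [DecidableEq μ]

theorem GramCongr.refl (S : Matrix ι ι ℤ) : GramCongr S S :=
  ⟨1, 1, by simp, by simp, by simp⟩

theorem GramCongr.trans {S : Matrix ι ι ℤ} {T : Matrix κ κ ℤ} {R : Matrix μ μ ℤ}
    (h : GramCongr S T) (h' : GramCongr T R) : GramCongr S R := by
  obtain ⟨U, V, hUV, hVU, rfl⟩ := h
  obtain ⟨U', V', hUV', hVU', rfl⟩ := h'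
  refine ⟨U * U', V' * V, ?_, ?_, ?_⟩
  · rw [Matrix.mul_assoc, ← Matrix.mul_assoc U', hUV', Matrix.one_mul, hUV]
  · rw [Matrix.mul_assoc, ← Matrix.mul_assoc V, hVU, Matrix.one_mul, hVU']
  · simp only [Matrix.transpose_mul, Matrix.mul_assoc]

theorem GramCongr.reindex (S : Matrix ι ι ℤ) (e : κ ≃ ι) : GramCongr S (S.submatrix e e) := by
  refine ⟨(1 : Matrix ι ι ℤ).submatrix id e, (1 : Matrix ι ι ℤ).submatrix e id, ?_, ?_, ?_⟩
  · rw [Matrix.submatrix_mul_equiv]; simp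
  · rw [← Matrix.submatrix_mul _ _ _ _ _ Function.bijective_id]; simp
  · ext i j
    simp [Matrix.mul_apply, Matrix.one_apply]

theorem GramCongr.pos {S : Matrix ι ι ℤ} {T : Matrix κ κ ℤ} (h : GramCongr S T)
    (hS : GramPos S) : GramPos T := by
  obtain ⟨U, V, hUV, hVU, rfl⟩ := h
  intro x hx
  rw [dotProduct_congr_mulVec]
  refine hS _ fun h0 => hx ?_
  have := congrArg V.mulVec h0
  rwa [Matrix.mulVec_mulVec, hVU, Matrix.one_mulVec, Matrix.mulVec_zero] at this

theorem GramCongr.even {S : Matrix ι ι ℤ} {T : Matrix κ κ ℤ} (h : GramCongr S T)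
    (hS : GramEven S) : GramEven T := by
  obtain ⟨U, V, hUV, hVU, rfl⟩ := h
  intro x
  rw [dotProduct_congr_mulVec]
  exact hS _

theorem GramCongr.isSymm {S : Matrix ι ι ℤ} {T : Matrix κ κ ℤ} (h : GramCongr S T)
    (hS : S.IsSymm) : T.IsSymm := by
  obtain ⟨U, V, hUV, hVU, rfl⟩ := h
  simp only [Matrix.IsSymm, Matrix.transpose_mul, Matrix.transpose_transpose, hS.eq,
    Matrix.mul_assoc]

theorem GramCongr.det_eq {S : Matrix ι ι ℤ} {T : Matrix κ κ ℤ} (h : GramCongr S T) :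
    T.det = S.det := by
  obtain ⟨U, V, hUV, hVU, rfl⟩ := h
  let e : ι ≃ κ := Fintype.equivOfCardEq (Matrix.square_of_invertible U V hUV hVU)
  have h1 : (U.submatrix id e) * (V.submatrix e id) = 1 := by
    rw [Matrix.submatrix_mul_equiv, hUV]; simp
  have h2 : ((U.transpose * S * U).submatrix e e) =
      (U.submatrix id e).transpose * S * (U.submatrix id e) := by
    ext i j; simp [Matrix.mul_apply]
  rw [← Matrix.det_submatrix_equiv_self e, h2, Matrix.det_mul, Matrix.det_mul,
    Matrix.det_transpose]
  have h3 : (U.submatrix id e).det * (V.submatrix e id).det = 1 := by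
    rw [← Matrix.det_mul, h1, Matrix.det_one]
  have h4 : (U.submatrix id e).det * (U.submatrix id e).det = 1 :=
    Int.isUnit_mul_self (IsUnit.of_mul_eq_one _ h3)
  linear_combination S.det * h4

theorem GramPos.apply_self {S : Matrix ι ι ℤ} (hS : GramPos S) (i : ι) : 0 < S i i := by
  have := hS (Pi.single i 1) (by simp)
  simpa using this

theorem GramEven.apply_self {S : Matrix ι ι ℤ} (hS : GramEven S) (i : ι) : Even (S i i) := by
  have := hS (Pi.single i 1)
  simpa using this

/-- Change of basis in the second block only. -/
theorem GramCongr.fromBlocks_right (A : Matrix ι ι ℤ) (B : Matrix ι κ ℤ) (C : Matrix κ ι ℤ)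
    (D : Matrix κ κ ℤ) {V : Matrix κ μ ℤ} {W : Matrix μ κ ℤ} (hVW : V * W = 1) (hWV : W * V = 1) :
    GramCongr (Matrix.fromBlocks A B C D)
      (Matrix.fromBlocks A (B * V) (V.transpose * C) (V.transpose * D * V)) := by
  refine ⟨Matrix.fromBlocks 1 0 0 V, Matrix.fromBlocks 1 0 0 W, ?_, ?_, ?_⟩
  · simp [Matrix.fromBlocks_multiply, hVW]
  · simp [Matrix.fromBlocks_multiply, hWV]
  · simp [Matrix.fromBlocks_multiply, Matrix.fromBlocks_transpose]

/-- Change of basis in the first block only. -/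
theorem GramCongr.fromBlocks_left (A : Matrix ι ι ℤ) (B : Matrix ι κ ℤ) (C : Matrix κ ι ℤ)
    (D : Matrix κ κ ℤ) {V : Matrix ι μ ℤ} {W : Matrix μ ι ℤ} (hVW : V * W = 1) (hWV : W * V = 1) :
    GramCongr (Matrix.fromBlocks A B C D)
      (Matrix.fromBlocks (V.transpose * A * V) (V.transpose * B) (C * V) D) := by
  refine ⟨Matrix.fromBlocks V 0 0 1, Matrix.fromBlocks W 0 0 1, ?_, ?_, ?_⟩
  · simp [Matrix.fromBlocks_multiply, hVW]
  · simp [Matrix.fromBlocks_multiply, hWV]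
  · simp [Matrix.fromBlocks_multiply, Matrix.fromBlocks_transpose]

/-- Adding to the vectors of the second block combinations of those of the first block. -/
theorem GramCongr.fromBlocks_shear (A : Matrix ι ι ℤ) (B : Matrix ι κ ℤ) (C : Matrix κ ι ℤ)
    (D : Matrix κ κ ℤ) (X : Matrix ι κ ℤ) :
    GramCongr (Matrix.fromBlocks A B C D)
      (Matrix.fromBlocks A (B + A * X) (C + X.transpose * A)
        (X.transpose * A * X + X.transpose * B + C * X + D)) := by
  refine ⟨Matrix.fromBlocks 1 X 0 1, Matrix.fromBlocks 1 (-X) 0 1, ?_, ?_, ?_⟩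
  · simp [Matrix.fromBlocks_multiply]
  · simp [Matrix.fromBlocks_multiply]
  · simp only [Matrix.fromBlocks_multiply, Matrix.fromBlocks_transpose, Matrix.transpose_one,
      Matrix.transpose_zero]
    congr 1
    · simp
    · simp [add_comm]
    · simp [add_comm]
    · simp [Matrix.add_mul, add_assoc, add_left_comm, add_comm]

end Congruence

/-- The Schur complement of `A` in the symmetric matrix with blocks `A, B, Bᵀ, D`, multiplied by
`det A` in order to stay integral. -/
def schurInt {ι κ : Type*} [Fintype ι] [DecidableEq ι]
    (A : Matrix ι ι ℤ) (B : Matrix ι κ ℤ) (D : Matrix κ κ ℤ) : Matrix κ κ ℤ :=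
  A.det • D - B.transpose * A.adjugate * B

theorem schurInt_congr {ι κ μ : Type*} [Fintype ι] [Fintype κ] [DecidableEq ι]
    (A : Matrix ι ι ℤ) (B : Matrix ι κ ℤ) (D : Matrix κ κ ℤ)
    (V : Matrix κ μ ℤ) :
    schurInt A (B * V) (V.transpose * D * V) = V.transpose * schurInt A B D * V := by
  simp only [schurInt, Matrix.mul_sub, Matrix.sub_mul, Matrix.transpose_mul, Matrix.mul_assoc,
    Matrix.smul_mul, Matrix.mul_smul]

section Schur

variable {ι κ : Type*} [Fintype ι] [DecidableEq ι]

theorem det_schurInt [Fintype κ] [DecidableEq κ] (A : Matrix ι ι ℤ) (B : Matrix ι κ ℤ)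
    (D : Matrix κ κ ℤ) :
    A.det * (schurInt A B D).det =
      A.det ^ Fintype.card κ * (Matrix.fromBlocks A B B.transpose D).det := by
  have h : Matrix.fromBlocks 1 0 (-(B.transpose * A.adjugate)) (A.det • (1 : Matrix κ κ ℤ)) *
      Matrix.fromBlocks A B B.transpose D = Matrix.fromBlocks A B 0 (schurInt A B D) := by
    rw [Matrix.fromBlocks_multiply]
    congr 1
    · simp
    · simp
    · rw [Matrix.neg_mul, Matrix.mul_assoc, Matrix.adjugate_mul, Matrix.mul_smul, Matrix.mul_one,
        Matrix.smul_mul, Matrix.one_mul, neg_add_cancel]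
    · simp [schurInt, sub_eq_neg_add]
  have h' := congrArg Matrix.det h
  rw [Matrix.det_mul, Matrix.det_fromBlocks_zero₁₂, Matrix.det_fromBlocks_zero₂₁,
    Matrix.det_smul, Matrix.det_one, Matrix.det_one] at h'
  linear_combination -h'

theorem GramPos.schurInt [Fintype κ] {A : Matrix ι ι ℤ} {B : Matrix ι κ ℤ} {D : Matrix κ κ ℤ}
    (hA : 0 < A.det) (h : GramPos (Matrix.fromBlocks A B B.transpose D)) :
    GramPos (schurInt A B D) := by
  intro y hy
  have hx : Sum.elim (-((A.adjugate * B).mulVec y)) (A.det • y) ≠ 0 := by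
    intro h0
    apply hy
    ext j
    have := congrFun h0 (Sum.inr j)
    simpa [hA.ne'] using this
  have key := h _ hx
  have e1 : A.mulVec (-((A.adjugate * B).mulVec y)) + B.mulVec (A.det • y) = 0 := by
    rw [Matrix.mulVec_neg, Matrix.mulVec_mulVec, ← Matrix.mul_assoc, Matrix.mul_adjugate,
      Matrix.mulVec_smul, Matrix.smul_mul, Matrix.one_mul, Matrix.smul_mulVec, neg_add_cancel]
  have e2 : B.transpose.mulVec (-((A.adjugate * B).mulVec y)) + D.mulVec (A.det • y) =
      (_root_.schurInt A B D).mulVec y := by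
    rw [_root_.schurInt, Matrix.sub_mulVec, Matrix.mulVec_neg, Matrix.mulVec_mulVec,
      Matrix.mulVec_smul, Matrix.smul_mulVec, Matrix.mul_assoc, neg_add_eq_sub]
  rw [Matrix.fromBlocks_mulVec] at key
  simp only [Sum.elim_comp_inl, Sum.elim_comp_inr, e1, e2, sumElim_dotProduct_sumElim,
    dotProduct_zero, zero_add, smul_dotProduct, smul_eq_mul] at key
  exact pos_of_mul_pos_right key hA.le

theorem schurInt_isSymm {A : Matrix ι ι ℤ} {B : Matrix ι κ ℤ} {D : Matrix κ κ ℤ}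
    (hA : A.IsSymm) (hD : D.IsSymm) : (schurInt A B D).IsSymm := by
  simp only [Matrix.IsSymm, schurInt, Matrix.transpose_sub, Matrix.transpose_smul,
    Matrix.transpose_mul, Matrix.transpose_transpose, hD.eq, Matrix.adjugate_transpose, hA.eq,
    Matrix.mul_assoc]

theorem schurInt_apply_eq_det {A : Matrix ι ι ℤ} (B : Matrix ι κ ℤ) (D : Matrix κ κ ℤ)
    (hA : A.det ≠ 0) (j : κ) :
    schurInt A B D j j = (Matrix.fromBlocks A (Matrix.replicateCol (Fin 1) fun i => B i j)
      (Matrix.replicateCol (Fin 1) fun i => B i j).transpose (Matrix.of fun _ _ => D j j)).det := by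
  have h := det_schurInt A (Matrix.replicateCol (Fin 1) fun i => B i j)
    (Matrix.of fun _ _ => D j j)
  simp only [Fintype.card_fin, pow_one] at h
  rw [← mul_left_cancel₀ hA h, Matrix.det_unique]
  simp only [schurInt, Matrix.sub_apply, Matrix.smul_apply, Matrix.mul_apply,
    Matrix.transpose_apply, Matrix.of_apply, Matrix.replicateCol_apply]

end Schur

section Hermite

theorem Matrix.mul_apply_fin_one {ι κ : Type*} (P : Matrix ι (Fin 1) ℤ) (Q : Matrix (Fin 1) κ ℤ)
    (i : ι) (j : κ) : (P * Q) i j = P i 0 * Q 0 j := by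
  simp [Matrix.mul_apply]

/-- The bijection `Fin 1 ⊕ Fin m ≃ Fin (m + 1)` which sends the left summand to `i`. -/
noncomputable def splitAt {m : ℕ} (i : Fin (m + 1)) : Fin 1 ⊕ Fin m ≃ Fin (m + 1) :=
  Equiv.ofBijective (Sum.elim (fun _ => i) i.succAbove) <| by
    rw [Fintype.bijective_iff_injective_and_card]
    refine ⟨?_, by simp [add_comm]⟩
    rintro (x | x) (y | y) h
    · rw [Subsingleton.elim x y]
    · exact absurd h.symm (i.succAbove_ne y)
    · exact absurd h (i.succAbove_ne x)
    · exact congrArg _ (Fin.succAbove_right_injective h)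

@[simp]
theorem splitAt_inl {m : ℕ} (i : Fin (m + 1)) (x : Fin 1) : splitAt i (Sum.inl x) = i := rfl

theorem Int.exists_two_mul_add_mul_sq_le (a b : ℤ) (ha : 0 < a) :
    ∃ c : ℤ, 4 * (b + c * a) ^ 2 ≤ a ^ 2 := by
  refine ⟨-((2 * b + a) / (2 * a)), ?_⟩
  have h1 := Int.emod_add_mul_ediv (2 * b + a) (2 * a)
  have h2 := Int.emod_nonneg (2 * b + a) (by omega : 2 * a ≠ 0)
  have h3 := Int.emod_lt_of_pos (2 * b + a) (by omega : 0 < 2 * a)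
  set q := (2 * b + a) / (2 * a)
  set r := (2 * b + a) % (2 * a)
  have h4 : 2 * (b + -q * a) = r - a := by linear_combination -h1
  have h5 : 4 * (b + -q * a) ^ 2 = (r - a) ^ 2 := by rw [← h4]; ring
  rw [h5]
  exact sq_le_sq' (by omega) (by omega)

/-- Some diagonal entry over all bases is minimal. -/
theorem exists_congr_minimal {ι : Type*} [Fintype ι] [DecidableEq ι] [Nonempty ι]
    {S : Matrix ι ι ℤ} (hS : GramPos S) :
    ∃ (T : Matrix ι ι ℤ) (i : ι), GramCongr S T ∧
      ∀ (R : Matrix ι ι ℤ) (j : ι), GramCongr S R → T i i ≤ R j j := by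
  classical
  have hex : ∃ n : ℕ, ∃ (T : Matrix ι ι ℤ) (i : ι), GramCongr S T ∧ T i i = n := by
    obtain ⟨i⟩ := ‹Nonempty ι›
    exact ⟨(S i i).toNat, S, i, .refl S, (Int.toNat_of_nonneg (hS.apply_self i).le).symm⟩
  obtain ⟨T, i, hT, hi⟩ := Nat.find_spec hex
  refine ⟨T, i, hT, fun R j hR => ?_⟩
  have hj := ((hR.pos hS).apply_self j).le
  have := Nat.find_min' hex ⟨R, j, hR, (Int.toNat_of_nonneg hj).symm⟩
  omega

/-- Hermite's bound: a positive definite integral form of rank `n` admits a basis one of whose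
vectors has square at most `(4/3) ^ ((n - 1) / 2) * det ^ (1 / n)`. -/
theorem exists_congr_hermite (m : ℕ) (S : Matrix (Fin (m + 1)) (Fin (m + 1)) ℤ)
    (hsymm : S.IsSymm) (hpos : GramPos S) :
    ∃ (T : Matrix (Fin (m + 1)) (Fin (m + 1)) ℤ) (i : Fin (m + 1)), GramCongr S T ∧
      T i i ^ (m + 1) * 3 ^ (m + 1).choose 2 ≤ 4 ^ (m + 1).choose 2 * S.det := by
  induction m with
  | zero => exact ⟨S, 0, .refl S, by simp⟩
  | succ m ih =>
    obtain ⟨T, i, hT, hmin⟩ := exists_congr_minimal hpos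
    refine ⟨T, i, hT, ?_⟩
    set a := T i i with ha
    have ha0 : 0 < a := (hT.pos hpos).apply_self i
    set R := T.submatrix (splitAt i) (splitAt i) with hR
    have hSR : GramCongr S R := hT.trans (.reindex T _)
    have hRsymm := hSR.isSymm hsymm
    set A := R.toBlocks₁₁
    set B := R.toBlocks₁₂
    set D := R.toBlocks₂₂
    have hBt : B.transpose = R.toBlocks₂₁ := by
      ext x y; exact hRsymm.apply _ _
    have hRb : R = Matrix.fromBlocks A B B.transpose D := by
      rw [hBt, Matrix.fromBlocks_toBlocks]
    have hAdet : A.det = a := by rw [Matrix.det_unique]; rfl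
    have hAsymm : A.IsSymm := by ext x y; exact hRsymm.apply _ _
    have hDsymm : D.IsSymm := by ext x y; exact hRsymm.apply _ _
    have hApos : 0 < A.det := hAdet ▸ ha0
    obtain ⟨_, j, ⟨V, W, hVW, hWV, rfl⟩, hj⟩ := ih (schurInt A B D)
      (schurInt_isSymm hAsymm hDsymm) (GramPos.schurInt hApos (hRb ▸ hSR.pos hpos))
    rw [← schurInt_congr] at hj
    set t := schurInt A (B * V) (V.transpose * D * V) j j with ht
    obtain ⟨c, hc⟩ := Int.exists_two_mul_add_mul_sq_le a ((B * V) 0 j) ha0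
    set X : Matrix (Fin 1) (Fin (m + 1)) ℤ := Matrix.of fun _ _ => c with hX
    set b := B * V with hb
    have hcongr := (hRb ▸ hSR).trans ((GramCongr.fromBlocks_right A B B.transpose D hVW hWV).trans
      (GramCongr.fromBlocks_shear _ _ _ _ X))
    have hle := hmin _ (splitAt i (Sum.inr j)) (hcongr.trans (.reindex _ (splitAt i).symm))
    have hAa : A 0 0 = a := rfl
    have hXc : X 0 j = c := rfl
    rw [← Matrix.transpose_mul, ← hb] at hle
    simp only [Matrix.submatrix_apply, Equiv.symm_apply_apply, Matrix.fromBlocks_apply₂₂,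
      Matrix.add_apply, Matrix.mul_apply_fin_one, Matrix.transpose_apply, hAa, hXc] at hle
    have e4 : t = a * (V.transpose * D * V) j j - b 0 j ^ 2 := by
      rw [ht, schurInt, hAdet, Matrix.sub_apply, Matrix.smul_apply,
        Matrix.adjugate_fin_one, Matrix.mul_one, Matrix.mul_apply_fin_one, Matrix.transpose_apply,
        smul_eq_mul, sq]
    have h3 : 3 * a ^ 2 ≤ 4 * t := by
      nlinarith [mul_le_mul_of_nonneg_left hle ha0.le]
    have hdet : (schurInt A B D).det = a ^ m * S.det := by
      have h := det_schurInt A B D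
      rw [← hRb, hSR.det_eq, hAdet, Fintype.card_fin, pow_succ', mul_assoc] at h
      exact mul_left_cancel₀ ha0.ne' h
    rw [hdet] at hj
    have hch : (m + 1 + 1).choose 2 = m + 1 + (m + 1).choose 2 := by
      rw [Nat.choose_succ_succ' (m + 1) 1, Nat.choose_one_right]
    have hpw : (3 * a ^ 2) ^ (m + 1) ≤ (4 * t) ^ (m + 1) :=
      pow_le_pow_left₀ (by positivity) h3 _
    have hfin : a ^ m * (a ^ (m + 1 + 1) * 3 ^ (m + 1 + 1).choose 2) ≤
        a ^ m * (4 ^ (m + 1 + 1).choose 2 * S.det) := by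
      calc a ^ m * (a ^ (m + 1 + 1) * 3 ^ (m + 1 + 1).choose 2)
          = (3 * a ^ 2) ^ (m + 1) * 3 ^ (m + 1).choose 2 := by rw [hch]; ring
        _ ≤ (4 * t) ^ (m + 1) * 3 ^ (m + 1).choose 2 := by gcongr
        _ = 4 ^ (m + 1) * (t ^ (m + 1) * 3 ^ (m + 1).choose 2) := by ring
        _ ≤ 4 ^ (m + 1) * (4 ^ (m + 1).choose 2 * (a ^ m * S.det)) := by gcongr
        _ = a ^ m * (4 ^ (m + 1 + 1).choose 2 * S.det) := by rw [hch]; ring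
    exact le_of_mul_le_mul_left hfin (by positivity)

end Hermite

section Bordered

/-- The Gram matrix `M` extended by one vector with products `u` with the old vectors and
square `s`. -/
def bordered {k : ℕ} (M : Matrix (Fin k) (Fin k) ℤ) (u : Fin k → ℤ) (s : ℤ) :
    Matrix (Fin (k + 1)) (Fin (k + 1)) ℤ :=
  (Matrix.fromBlocks M (Matrix.replicateCol (Fin 1) u) (Matrix.replicateCol (Fin 1) u).transpose
    (Matrix.of fun _ _ => s)).submatrix finSumFinEquiv.symm finSumFinEquiv.symm

variable {k : ℕ} {M : Matrix (Fin k) (Fin k) ℤ}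

theorem bordered_last (u : Fin k → ℤ) (s : ℤ) : bordered M u s (Fin.last k) (Fin.last k) = s := by
  simp [bordered]

theorem det_bordered (u : Fin k → ℤ) (s : ℤ) :
    (bordered M u s).det = (Matrix.fromBlocks M (Matrix.replicateCol (Fin 1) u)
      (Matrix.replicateCol (Fin 1) u).transpose (Matrix.of fun _ _ => s)).det :=
  Matrix.det_submatrix_equiv_self _ _

theorem det_bordered_of_mulVec_eq (hM : M.det ≠ 0) {u c : Fin k → ℤ} {e : ℤ} (s : ℤ)
    (h : M.mulVec c = e • u) : e * (bordered M u s).det = M.det * (e * s - u ⬝ᵥ c) := by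
  have h1 := schurInt_apply_eq_det (Matrix.replicateCol (Fin 1) u) (Matrix.of fun _ _ => s) hM 0
  have h2 : (schurInt M (Matrix.replicateCol (Fin 1) u) (Matrix.of fun _ _ => s)) 0 0 =
      M.det * s - u ⬝ᵥ M.adjugate.mulVec u := by
    rw [schurInt, Matrix.mul_assoc]
    rfl
  have h3 : e • M.adjugate.mulVec u = M.det • c := by
    rw [← Matrix.mulVec_smul, ← h, Matrix.mulVec_mulVec, Matrix.adjugate_mul, Matrix.smul_mulVec,
      Matrix.one_mulVec]
  have h4 : e * (u ⬝ᵥ M.adjugate.mulVec u) = M.det * (u ⬝ᵥ c) := by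
    rw [← smul_eq_mul, ← dotProduct_smul, h3, dotProduct_smul, smul_eq_mul]
  have h5 : (bordered M u s).det = M.det * s - u ⬝ᵥ M.adjugate.mulVec u := by
    rw [← h2, h1, det_bordered]
    rfl
  rw [h5]
  linear_combination -h4

theorem bordered_congr {u u' : Fin k → ℤ} {s s' : ℤ}
    (h : GramCongr
      (Matrix.fromBlocks M (Matrix.replicateCol (Fin 1) u)
        (Matrix.replicateCol (Fin 1) u).transpose (Matrix.of fun _ _ => s))
      (Matrix.fromBlocks M (Matrix.replicateCol (Fin 1) u')
        (Matrix.replicateCol (Fin 1) u').transpose (Matrix.of fun _ _ => s'))) :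
    GramCongr (bordered M u s) (bordered M u' s') := by
  have h1 := GramCongr.reindex (bordered M u s) finSumFinEquiv
  rw [bordered, Matrix.submatrix_submatrix, Equiv.symm_comp_self, Matrix.submatrix_id_id] at h1
  exact h1.trans (h.trans (.reindex _ finSumFinEquiv.symm))

theorem bordered_neg_congr (u : Fin k → ℤ) (s : ℤ) :
    GramCongr (bordered M u s) (bordered M (-u) s) := by
  have hV : (-1 : Matrix (Fin 1) (Fin 1) ℤ) * (-1) = 1 := by
    rw [neg_mul_neg, Matrix.mul_one]
  have h := GramCongr.fromBlocks_right M (Matrix.replicateCol (Fin 1) u)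
    (Matrix.replicateCol (Fin 1) u).transpose (Matrix.of fun _ _ => s) hV hV
  refine bordered_congr ?_
  convert h using 1
  congr 1
  · ext; simp
  · ext; simp
  · simp

theorem bordered_shear_congr (hM : M.IsSymm) (u a : Fin k → ℤ) (s : ℤ) :
    ∃ s', GramCongr (bordered M u s) (bordered M (u + M.mulVec a) s') := by
  have h := GramCongr.fromBlocks_shear M (Matrix.replicateCol (Fin 1) u)
    (Matrix.replicateCol (Fin 1) u).transpose (Matrix.of fun _ _ => s)
    (Matrix.replicateCol (Fin 1) a)
  refine ⟨(show Matrix (Fin 1) (Fin 1) ℤ from (Matrix.replicateCol (Fin 1) a).transpose * M *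
        Matrix.replicateCol (Fin 1) a +
      (Matrix.replicateCol (Fin 1) a).transpose * Matrix.replicateCol (Fin 1) u +
      (Matrix.replicateCol (Fin 1) u).transpose * Matrix.replicateCol (Fin 1) a +
      Matrix.of fun _ _ => s) 0 0, bordered_congr ?_⟩
  convert h using 1
  have e : Matrix.replicateCol (Fin 1) (u + M.mulVec a) =
      Matrix.replicateCol (Fin 1) u + M * Matrix.replicateCol (Fin 1) a := by
    ext; simp [Matrix.mul_apply, Matrix.mulVec, dotProduct]
  rw [e, Matrix.transpose_add, Matrix.transpose_mul, hM.eq]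
  congr 1

end Bordered

section HasBlock

/-- The lattice with Gram matrix `G` has a basis with `k + m` elements, the first `k` of which have
Gram matrix `M`. -/
def HasBlock {ι : Type*} [Fintype ι] [DecidableEq ι] (G : Matrix ι ι ℤ) {k : ℕ} (m : ℕ)
    (M : Matrix (Fin k) (Fin k) ℤ) : Prop :=
  ∃ S : Matrix (Fin k ⊕ Fin m) (Fin k ⊕ Fin m) ℤ, GramCongr G S ∧ S.toBlocks₁₁ = M

variable {ι : Type*} [Fintype ι] [DecidableEq ι] {G : Matrix ι ι ℤ} {k m : ℕ}
  {M : Matrix (Fin k) (Fin k) ℤ}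

theorem HasBlock.congr {M' : Matrix (Fin k) (Fin k) ℤ} (h : HasBlock G m M)
    (h' : GramCongr M M') : HasBlock G m M' := by
  obtain ⟨S, hS, rfl⟩ := h
  obtain ⟨U, V, hUV, hVU, rfl⟩ := h'
  have h := GramCongr.fromBlocks_left S.toBlocks₁₁ S.toBlocks₁₂ S.toBlocks₂₁ S.toBlocks₂₂ hUV hVU
  rw [Matrix.fromBlocks_toBlocks] at h
  exact ⟨_, hS.trans h, Matrix.toBlocks_fromBlocks₁₁ _ _ _ _⟩

theorem HasBlock.isSymm (h : HasBlock G m M) (hG : G.IsSymm) : M.IsSymm := by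
  obtain ⟨S, hS, rfl⟩ := h
  ext x y
  exact (hS.isSymm hG).apply _ _

theorem HasBlock.even_apply_self (h : HasBlock G m M) (hG : GramEven G) (i : Fin k) :
    Even (M i i) := by
  obtain ⟨S, hS, rfl⟩ := h
  exact (hS.even hG).apply_self _

theorem hasBlock_empty {n : ℕ} (G : Matrix (Fin n) (Fin n) ℤ) :
    HasBlock G n (1 : Matrix (Fin 0) (Fin 0) ℤ) :=
  ⟨_, .reindex G (Equiv.emptySum (Fin 0) (Fin n)), Subsingleton.elim _ _⟩

theorem HasBlock.gramCongr (h : HasBlock G 0 M) : GramCongr G M := by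
  obtain ⟨S, hS, rfl⟩ := h
  exact hS.trans (.reindex S (Equiv.sumEmpty (Fin k) (Fin 0)).symm)

/-- A partial basis of a positive definite unimodular lattice extends by a vector whose distance to
the span of the earlier ones obeys Hermite's bound. -/
theorem HasBlock.exists_bordered (h : HasBlock G (m + 1) M) (hsymm : G.IsSymm) (hpos : GramPos G)
    (hdet : G.det = 1) (hM : 0 < M.det) :
    ∃ u s, HasBlock G m (bordered M u s) ∧ 0 < (bordered M u s).det ∧
      (bordered M u s).det ^ (m + 1) * 3 ^ (m + 1).choose 2 ≤
        4 ^ (m + 1).choose 2 * M.det ^ m := by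
  obtain ⟨S, hS, rfl⟩ := h
  have hSsymm := hS.isSymm hsymm
  set A := S.toBlocks₁₁
  set B := S.toBlocks₁₂
  set D := S.toBlocks₂₂
  have hBt : B.transpose = S.toBlocks₂₁ := by
    ext x y; exact hSsymm.apply _ _
  have hSb : S = Matrix.fromBlocks A B B.transpose D := by
    rw [hBt, Matrix.fromBlocks_toBlocks]
  have hAsymm : A.IsSymm := by ext x y; exact hSsymm.apply _ _
  have hDsymm : D.IsSymm := by ext x y; exact hSsymm.apply _ _
  have hTpos : GramPos (schurInt A B D) := GramPos.schurInt hM (hSb ▸ hS.pos hpos)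
  obtain ⟨T, j, hT, hj⟩ := exists_congr_hermite m _ (schurInt_isSymm hAsymm hDsymm) hTpos
  have hTj := (hT.pos hTpos).apply_self j
  obtain ⟨V, W, hVW, hWV, rfl⟩ := hT
  rw [← schurInt_congr] at hj hTj
  have hdetS : (schurInt A B D).det = A.det ^ m := by
    have h := det_schurInt A B D
    rw [← hSb, hS.det_eq, hdet, Fintype.card_fin, pow_succ', mul_one] at h
    exact mul_left_cancel₀ hM.ne' h
  rw [schurInt_apply_eq_det _ _ hM.ne', ← det_bordered] at hj hTj
  rw [hdetS] at hj
  refine ⟨_, _, ⟨_, (hSb ▸ hS).trans ((GramCongr.fromBlocks_right A B _ D hVW hWV).trans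
    (.reindex _ ((finSumFinEquiv.symm.sumCongr (Equiv.refl (Fin m))).trans
      ((Equiv.sumAssoc _ _ _).trans ((Equiv.refl _).sumCongr (splitAt j)))))), ?_⟩, hTj, hj⟩
  ext x y
  obtain ⟨x, rfl⟩ := finSumFinEquiv.surjective x
  obtain ⟨y, rfl⟩ := finSumFinEquiv.surjective y
  rw [← Matrix.transpose_mul]
  rcases x with x | x <;> rcases y with y | y <;>
    simp [bordered, Matrix.toBlocks₁₁, -Matrix.transpose_mul]

/-- The new vector of `HasBlock.exists_bordered`, normalised modulo the span of the earlier ones and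
up to sign. The columns of `P` represent generators of the cokernel of `M`, which is killed
by `e`, and `r` gives the coordinates of the new vector with respect to them. -/
theorem HasBlock.exists_bordered_reduced {p : ℕ} (h : HasBlock G (m + 1) M) (hsymm : G.IsSymm)
    (hpos : GramPos G) (heven : GramEven G) (hdet : G.det = 1) {d : ℤ} (hM : M.det = d)
    (hd : 0 < d) (P : Matrix (Fin k) (Fin p) ℤ) (L : Matrix (Fin p) (Fin k) ℤ)
    (N : Matrix (Fin k) (Fin k) ℤ) (C : Matrix (Fin k) (Fin p) ℤ) (e : ℤ)
    (hN : M * N + P * L = 1) (hC : M * C = e • P) (Q : (Fin p → ℤ) → Prop)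
    (hQ : ∀ w : Fin p → ℤ, ∃ r q, Q r ∧ (w = r + e • q ∨ -w = r + e • q)) (b : ℤ)
    (hb : 4 ^ (m + 1).choose 2 * d ^ m < (b + 1) ^ (m + 1) * 3 ^ (m + 1).choose 2) (hb0 : 0 ≤ b) :
    ∃ r s t, Q r ∧ HasBlock G m (bordered M (P.mulVec r) s) ∧
      (bordered M (P.mulVec r) s).det = t ∧ Even s ∧ 0 < t ∧ t ≤ b ∧
      e * t = d * (e * s - P.mulVec r ⬝ᵥ C.mulVec r) := by
  subst hM
  have hMsymm := h.isSymm hsymm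
  obtain ⟨u, s, hus, h0, hle⟩ := h.exists_bordered hsymm hpos hdet hd
  have hred : ∃ r s', Q r ∧ GramCongr (bordered M u s) (bordered M (P.mulVec r) s') := by
    obtain ⟨r, q, hr, hw⟩ := hQ (L.mulVec u)
    have key : ∀ v : Fin k → ℤ, L.mulVec v = r + e • q →
        ∃ s', GramCongr (bordered M v s) (bordered M (P.mulVec r) s') := by
      intro v hv
      have hcomb : v + M.mulVec (-(N.mulVec v) - C.mulVec q) = P.mulVec r := by
        have h1 : M.mulVec (N.mulVec v) + P.mulVec (L.mulVec v) = v := by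
          rw [Matrix.mulVec_mulVec, Matrix.mulVec_mulVec, ← Matrix.add_mulVec, hN,
            Matrix.one_mulVec]
        have h2 : M.mulVec (C.mulVec q) = e • P.mulVec q := by
          rw [Matrix.mulVec_mulVec, hC, Matrix.smul_mulVec]
        rw [Matrix.mulVec_sub, Matrix.mulVec_neg, h2]
        nth_rewrite 1 [← h1]
        rw [hv, Matrix.mulVec_add, Matrix.mulVec_smul]
        abel
      rw [← hcomb]
      exact bordered_shear_congr hMsymm _ _ _
    rcases hw with hw | hw
    · obtain ⟨s', hs'⟩ := key u hw
      exact ⟨r, s', hr, hs'⟩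
    · obtain ⟨s', hs'⟩ := key (-u) (by rw [Matrix.mulVec_neg, hw])
      exact ⟨r, s', hr, (bordered_neg_congr u s).trans hs'⟩
  obtain ⟨r, s', hr, hs'⟩ := hred
  have hblock := hus.congr hs'
  rw [← hs'.det_eq] at h0 hle
  refine ⟨r, s', _, hr, hblock, rfl, ?_, h0, ?_, ?_⟩
  · simpa only [bordered_last] using hblock.even_apply_self heven (Fin.last k)
  · by_contra! hlt
    have : (b + 1) ^ (m + 1) ≤ (bordered M (P.mulVec r) s').det ^ (m + 1) :=
      pow_le_pow_left₀ (by omega) (by omega) _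
    have := mul_le_mul_of_nonneg_right this (by positivity : (0 : ℤ) ≤ 3 ^ (m + 1).choose 2)
    omega
  · refine det_bordered_of_mulVec_eq hd.ne' s' ?_
    rw [Matrix.mulVec_mulVec, hC, Matrix.smul_mulVec]

end HasBlock

section Extension

variable {ι : Type*} [Fintype ι] [DecidableEq ι] {G : Matrix ι ι ℤ} {k m : ℕ}
  {M : Matrix (Fin k) (Fin k) ℤ}

/-- The Gram matrices of positive definite even unimodular lattices. -/
structure EvenUnimodularPos (G : Matrix ι ι ℤ) : Prop where
  isSymm : G.IsSymm
  pos : GramPos G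
  even : GramEven G
  det_eq : G.det = 1

/-- The lattice with Gram matrix `G` has a basis with `k + m` elements, the first `k` of which have
Gram matrix `M`, and `M` has determinant `d`. -/
def HasBlockDet (G : Matrix ι ι ℤ) {k : ℕ} (m : ℕ) (M : Matrix (Fin k) (Fin k) ℤ) (d : ℤ) : Prop :=
  HasBlock G m M ∧ M.det = d

theorem HasBlockDet.congr {M' : Matrix (Fin k) (Fin k) ℤ} {d : ℤ} (h : HasBlockDet G m M d)
    (h' : GramCongr M M') : HasBlockDet G m M' d :=
  ⟨h.1.congr h', h'.det_eq.trans h.2⟩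

/-- Version of `HasBlock.exists_bordered_reduced` for a cyclic cokernel. -/
theorem HasBlockDet.exists_bordered_cyclic {d : ℤ} (h : HasBlockDet G (m + 1) M d)
    (hG : EvenUnimodularPos G) (P : Matrix (Fin k) (Fin 1) ℤ) (L : Matrix (Fin 1) (Fin k) ℤ)
    (N : Matrix (Fin k) (Fin k) ℤ) (C : Matrix (Fin k) (Fin 1) ℤ) (e n b : ℤ)
    (hN : M * N + P * L = 1) (hC : M * C = e • P) (hn : (P.transpose * C) 0 0 = n)
    (hd : 0 < d) (he : 0 < e) (hb0 : 0 ≤ b)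
    (hb : 4 ^ (m + 1).choose 2 * d ^ m < (b + 1) ^ (m + 1) * 3 ^ (m + 1).choose 2) :
    ∃ a s t : ℤ, 0 ≤ a ∧ 2 * a ≤ e ∧ HasBlockDet G m (bordered M (P.mulVec ![a]) s) t ∧
      s % 2 = 0 ∧ 0 < t ∧ t ≤ b ∧ e * t = d * (e * s - n * a ^ 2) := by
  have hQ : ∀ w : Fin 1 → ℤ, ∃ r q : Fin 1 → ℤ, (0 ≤ r 0 ∧ 2 * r 0 ≤ e) ∧
      (w = r + e • q ∨ -w = r + e • q) := by
    intro w
    have h1 := Int.emod_add_mul_ediv (w 0) e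
    have h2 := Int.emod_nonneg (w 0) he.ne'
    have h3 := Int.emod_lt_of_pos (w 0) he
    by_cases hle : 2 * (w 0 % e) ≤ e
    · refine ⟨fun _ => w 0 % e, fun _ => w 0 / e, ⟨h2, hle⟩, Or.inl ?_⟩
      ext i
      rw [Subsingleton.elim i 0]
      exact h1.symm
    · refine ⟨fun _ => e - w 0 % e, fun _ => -(w 0 / e) - 1,
        ⟨by dsimp only; omega, by dsimp only; omega⟩, Or.inr ?_⟩
      ext i
      rw [Subsingleton.elim i 0]
      change -w 0 = e - w 0 % e + e * (-(w 0 / e) - 1)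
      linear_combination h1
  obtain ⟨r, s, t, ⟨h0, h1⟩, hr, hdet, hs, ht0, htb, heq⟩ :=
    h.1.exists_bordered_reduced hG.isSymm hG.pos hG.even hG.det_eq h.2 hd P L N C e hN hC
      (fun r => 0 ≤ r 0 ∧ 2 * r 0 ≤ e) hQ b hb hb0
  have hr0 : r = ![r 0] := by
    ext i; rw [Subsingleton.elim i 0]; rfl
  refine ⟨r 0, s, t, h0, h1, ⟨hr0 ▸ hr, hr0 ▸ hdet⟩, Int.even_iff.mp hs, ht0, htb, ?_⟩
  rw [heq, ← hn]
  congr 2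
  simp only [dotProduct, Matrix.mulVec, Matrix.mul_apply, Matrix.transpose_apply,
    Finset.univ_unique, Finset.sum_singleton, Fin.default_eq_zero, Finset.sum_mul]
  exact Finset.sum_congr rfl fun i _ => by ring

/-- Version of `HasBlock.exists_bordered_reduced` for a cokernel killed by `2` with two
generators. -/
theorem HasBlockDet.exists_bordered_klein {d : ℤ} (h : HasBlockDet G (m + 1) M d)
    (hG : EvenUnimodularPos G) (P : Matrix (Fin k) (Fin 2) ℤ) (L : Matrix (Fin 2) (Fin k) ℤ)
    (N : Matrix (Fin k) (Fin k) ℤ) (C : Matrix (Fin k) (Fin 2) ℤ) (b : ℤ)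
    (hN : M * N + P * L = 1) (hC : M * C = (2 : ℤ) • P) (hd : 0 < d) (hb0 : 0 ≤ b)
    (hb : 4 ^ (m + 1).choose 2 * d ^ m < (b + 1) ^ (m + 1) * 3 ^ (m + 1).choose 2) :
    ∃ (r : Fin 2 → ℤ) (s t : ℤ), (r = ![0, 0] ∨ r = ![0, 1] ∨ r = ![1, 0] ∨ r = ![1, 1]) ∧
      HasBlockDet G m (bordered M (P.mulVec r) s) t ∧
      s % 2 = 0 ∧ 0 < t ∧ t ≤ b ∧ 2 * t = d * (2 * s - P.mulVec r ⬝ᵥ C.mulVec r) := by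
  have hQ' : ∀ w : Fin 2 → ℤ, ∃ r q : Fin 2 → ℤ,
      (r = ![0, 0] ∨ r = ![0, 1] ∨ r = ![1, 0] ∨ r = ![1, 1]) ∧
      (w = r + (2 : ℤ) • q ∨ -w = r + (2 : ℤ) • q) := by
    intro w
    refine ⟨![w 0 % 2, w 1 % 2], ![w 0 / 2, w 1 / 2], ?_, Or.inl ?_⟩
    · rcases Int.emod_two_eq_zero_or_one (w 0) with h0 | h0 <;>
        rcases Int.emod_two_eq_zero_or_one (w 1) with h1 | h1 <;> simp [h0, h1]
    · ext i
      fin_cases i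
      · exact (Int.emod_add_mul_ediv (w 0) 2).symm
      · exact (Int.emod_add_mul_ediv (w 1) 2).symm
  obtain ⟨r, s, t, hQ, hr, hdet, hs, ht0, htb, heq⟩ :=
    h.1.exists_bordered_reduced hG.isSymm hG.pos hG.even hG.det_eq h.2 hd P L N C 2 hN hC
      (fun r => r = ![0, 0] ∨ r = ![0, 1] ∨ r = ![1, 0] ∨ r = ![1, 1]) hQ' b hb hb0
  exact ⟨r, s, t, hQ, ⟨hr, hdet⟩, Int.even_iff.mp hs, ht0, htb, heq⟩

end Extension

section RootLattices

/-- The Gram matrix of the first `k` simple roots of `E₈`. For `k = 4, 5, 6, 7` it is the Gram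
matrix of `A₄`, `D₅`, `E₆`, `E₇`. -/
def leadingE8 (k : ℕ) (h : k ≤ 8 := by decide) : Matrix (Fin k) (Fin k) ℤ :=
  E8M.submatrix (Fin.castLE h) (Fin.castLE h)

/-- The Gram matrix of the root lattice `A₂`. -/
def gramA2 : Matrix (Fin 2) (Fin 2) ℤ := !![2, -1; -1, 2]

/-- The Gram matrix of the root lattice `A₃`, the last simple root being the middle one. -/
def gramA3 : Matrix (Fin 3) (Fin 3) ℤ := !![2, 0, -1; 0, 2, -1; -1, -1, 2]

/-- The Gram matrix of the root lattice `D₄`, the last simple root being the central one. -/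
def gramD4 : Matrix (Fin 4) (Fin 4) ℤ := !![2, 0, 0, -1; 0, 2, 0, -1; 0, 0, 2, -1; -1, -1, -1, 2]

variable {ι : Type*} [Fintype ι] [DecidableEq ι] {G : Matrix ι ι ℤ}

theorem EvenUnimodularPos.hasBlockDet_A1 {G : Matrix (Fin 8) (Fin 8) ℤ}
    (hG : EvenUnimodularPos G) : HasBlockDet G 7 (leadingE8 1) 2 := by
  obtain ⟨r, s, t, -, hr, hdet, hs, ht0, htb, heq⟩ :=
    (hasBlock_empty G).exists_bordered_reduced hG.isSymm hG.pos hG.even hG.det_eq (d := 1)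
      (by simp) one_pos (0 : Matrix (Fin 0) (Fin 0) ℤ) 0 0 0 1 (Subsingleton.elim _ _)
      (Subsingleton.elim _ _) (fun _ => True)
      (fun w => ⟨w, 0, trivial, Or.inl (Subsingleton.elim _ _)⟩) 2
      (by norm_num [Nat.choose]) (by norm_num)
  have hs' := Int.even_iff.mp hs
  obtain rfl : r = ![] := Subsingleton.elim _ _
  rw [show Matrix.mulVec (0 : Matrix (Fin 0) (Fin 0) ℤ) ![] ⬝ᵥ
    Matrix.mulVec (0 : Matrix (Fin 0) (Fin 0) ℤ) ![] = 0 by decide +kernel] at heq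
  obtain rfl : s = 2 := by omega
  obtain rfl : t = 2 := by omega
  exact HasBlockDet.congr ⟨hr, hdet⟩ ⟨1, 1, by decide +kernel, by decide +kernel, by decide +kernel⟩

theorem HasBlockDet.extend_A1 (hG : EvenUnimodularPos G)
    (h : HasBlockDet G 7 (leadingE8 1) 2) :
    HasBlockDet G 6 (leadingE8 2) 4 ∨ HasBlockDet G 6 gramA2 3 := by
  obtain ⟨a, s, t, ha0, ha, h, hs, ht0, ht, heq⟩ := h.exists_bordered_cyclic hG
    !![-1]
    !![1]
    !![1]
    !![-1]
    2 1 4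
    (by decide +kernel) (by decide +kernel) (by decide +kernel) (by decide) (by decide) (by decide)
    (by norm_num [Nat.choose])
  have ha' : a ≤ 1 := by omega
  interval_cases a <;> norm_num at heq
  · obtain rfl : s = 2 := by omega
    obtain rfl : t = 4 := by omega
    exact Or.inl <|
      h.congr ⟨1, 1, by decide +kernel, by decide +kernel, by decide +kernel⟩
  · obtain rfl : s = 2 := by omega
    obtain rfl : t = 3 := by omega
    exact Or.inr <|
      h.congr ⟨1, 1, by decide +kernel, by decide +kernel, by decide +kernel⟩

theorem HasBlockDet.extend_A1A1 (hG : EvenUnimodularPos G)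
    (h : HasBlockDet G 6 (leadingE8 2) 4) :
    HasBlockDet G 5 (leadingE8 3) 6 ∨ HasBlockDet G 5 gramA3 4 := by
  obtain ⟨r, s, t, hr, h, hs, ht0, ht, heq⟩ := h.exists_bordered_klein hG
    !![-1, 0; 0, -1]
    !![1, 0; 0, 1]
    !![1, 0; 0, 1]
    !![-1, 0; 0, -1]
    6
    (by decide +kernel) (by decide +kernel) (by decide) (by decide) (by norm_num [Nat.choose])
  rcases hr with rfl | rfl | rfl | rfl
  · rw [show Matrix.mulVec _ ![0, 0] ⬝ᵥ Matrix.mulVec _ ![0, 0] = (0 : ℤ) by decide +kernel] at heq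
    omega
  · rw [show Matrix.mulVec _ ![0, 1] ⬝ᵥ Matrix.mulVec _ ![0, 1] = (1 : ℤ) by decide +kernel] at heq
    obtain rfl : s = 2 := by omega
    obtain rfl : t = 6 := by omega
    exact Or.inl <|
      h.congr ⟨!![0, 1, 0; 1, 0, 0; 0, 0, 1], !![0, 1, 0; 1, 0, 0; 0, 0, 1],
      by decide +kernel, by decide +kernel, by decide +kernel⟩
  · rw [show Matrix.mulVec _ ![1, 0] ⬝ᵥ Matrix.mulVec _ ![1, 0] = (1 : ℤ) by decide +kernel] at heq
    obtain rfl : s = 2 := by omega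
    obtain rfl : t = 6 := by omega
    exact Or.inl <|
      h.congr ⟨1, 1, by decide +kernel, by decide +kernel, by decide +kernel⟩
  · rw [show Matrix.mulVec _ ![1, 1] ⬝ᵥ Matrix.mulVec _ ![1, 1] = (2 : ℤ) by decide +kernel] at heq
    obtain rfl : s = 2 := by omega
    obtain rfl : t = 4 := by omega
    exact Or.inr <|
      h.congr ⟨1, 1, by decide +kernel, by decide +kernel, by decide +kernel⟩

theorem HasBlockDet.extend_A2 (hG : EvenUnimodularPos G)
    (h : HasBlockDet G 6 gramA2 3) :
    HasBlockDet G 5 gramA3 4 := by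
  obtain ⟨a, s, t, ha0, ha, h, hs, ht0, ht, heq⟩ := h.exists_bordered_cyclic hG
    !![0; -1]
    !![1, 2]
    !![1, 1; 1, 2]
    !![-1; -2]
    3 2 5
    (by decide +kernel) (by decide +kernel) (by decide +kernel) (by decide) (by decide) (by decide)
    (by norm_num [Nat.choose])
  have ha' : a ≤ 1 := by omega
  interval_cases a <;> norm_num at heq
  · omega
  · obtain rfl : s = 2 := by omega
    obtain rfl : t = 4 := by omega
    exact h.congr
      ⟨!![1, 0, 0; 0, 0, 1; 0, 1, 0], !![1, 0, 0; 0, 0, 1; 0, 1, 0],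
      by decide +kernel, by decide +kernel, by decide +kernel⟩

theorem HasBlockDet.extend_A2A1 (hG : EvenUnimodularPos G)
    (h : HasBlockDet G 5 (leadingE8 3) 6) :
    HasBlockDet G 4 (leadingE8 4) 5 := by
  obtain ⟨a, s, t, ha0, ha, h, hs, ht0, ht, heq⟩ := h.exists_bordered_cyclic hG
    !![0; -1; -1]
    !![4, 3, 2]
    !![2, 1, 1; 2, 2, 1; 3, 2, 2]
    !![-2; -3; -4]
    6 7 7
    (by decide +kernel) (by decide +kernel) (by decide +kernel) (by decide) (by decide) (by decide)
    (by norm_num [Nat.choose])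
  have ha' : a ≤ 3 := by omega
  interval_cases a <;> norm_num at heq
  · omega
  · obtain rfl : s = 2 := by omega
    obtain rfl : t = 5 := by omega
    exact h.congr ⟨1, 1, by decide +kernel, by decide +kernel, by decide +kernel⟩
  · omega
  · omega

theorem HasBlockDet.extend_A3 (hG : EvenUnimodularPos G)
    (h : HasBlockDet G 5 gramA3 4) :
    HasBlockDet G 4 (leadingE8 4) 5 ∨ HasBlockDet G 4 gramD4 4 := by
  obtain ⟨a, s, t, ha0, ha, h, hs, ht0, ht, heq⟩ := h.exists_bordered_cyclic hG
    !![0; -1; 0]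
    !![1, 3, 2]
    !![1, 1, 1; 1, 3, 2; 1, 2, 2]
    !![-1; -3; -2]
    4 3 5
    (by decide +kernel) (by decide +kernel) (by decide +kernel) (by decide) (by decide) (by decide)
    (by norm_num [Nat.choose])
  have ha' : a ≤ 2 := by omega
  interval_cases a <;> norm_num at heq
  · omega
  · obtain rfl : s = 2 := by omega
    obtain rfl : t = 5 := by omega
    exact Or.inl <|
      h.congr ⟨!![1, 0, 0, 0; 0, 1, 1, -1; 0, 0, 1, 0; 0, 0, 1, -1],
        !![1, 0, 0, 0; 0, 1, 0, -1; 0, 0, 1, 0; 0, 0, 1, -1],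
        by decide +kernel, by decide +kernel, by decide +kernel⟩
  · obtain rfl : s = 4 := by omega
    obtain rfl : t = 4 := by omega
    exact Or.inr <|
      h.congr ⟨!![1, 0, 0, 0; 0, 1, 1, 0; 0, 0, 0, 1; 0, 0, 1, 0],
        !![1, 0, 0, 0; 0, 1, 0, -1; 0, 0, 0, 1; 0, 0, 1, 0],
        by decide +kernel, by decide +kernel, by decide +kernel⟩

theorem HasBlockDet.extend_A4 (hG : EvenUnimodularPos G)
    (h : HasBlockDet G 4 (leadingE8 4) 5) :
    HasBlockDet G 3 (leadingE8 5) 4 := by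
  obtain ⟨a, s, t, ha0, ha, h, hs, ht0, ht, heq⟩ := h.exists_bordered_cyclic hG
    !![0; 0; 0; -1]
    !![3, 2, 1, 4]
    !![2, 1, 1, 2; 2, 2, 1, 3; 3, 2, 2, 4; 4, 3, 2, 6]
    !![-2; -3; -4; -6]
    5 6 5
    (by decide +kernel) (by decide +kernel) (by decide +kernel) (by decide) (by decide) (by decide)
    (by norm_num [Nat.choose])
  have ha' : a ≤ 2 := by omega
  interval_cases a <;> norm_num at heq
  · omega
  · obtain rfl : s = 2 := by omega
    obtain rfl : t = 4 := by omega
    exact h.congr ⟨1, 1, by decide +kernel, by decide +kernel, by decide +kernel⟩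
  · omega

theorem HasBlockDet.extend_D4 (hG : EvenUnimodularPos G)
    (h : HasBlockDet G 4 gramD4 4) :
    HasBlockDet G 3 (leadingE8 5) 4 := by
  obtain ⟨r, s, t, hr, h, hs, ht0, ht, heq⟩ := h.exists_bordered_klein hG
    !![-1, 0; 0, -1; 0, 0; 0, 0]
    !![1, 0, 1, 0; 0, 1, 1, 0]
    !![2, 1, 2, 1; 1, 2, 2, 1; 1, 1, 2, 1; 2, 2, 3, 2]
    !![-2, -1; -1, -2; -1, -1; -2, -2]
    4
    (by decide +kernel) (by decide +kernel) (by decide) (by decide) (by norm_num [Nat.choose])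
  rcases hr with rfl | rfl | rfl | rfl
  · rw [show Matrix.mulVec _ ![0, 0] ⬝ᵥ Matrix.mulVec _ ![0, 0] = (0 : ℤ) by decide +kernel] at heq
    omega
  · rw [show Matrix.mulVec _ ![0, 1] ⬝ᵥ Matrix.mulVec _ ![0, 1] = (2 : ℤ) by decide +kernel] at heq
    obtain rfl : s = 2 := by omega
    obtain rfl : t = 4 := by omega
    exact h.congr
      ⟨!![1, 0, 0, 0, -1; 0, 1, 1, -1, -1; 0, 0, 0, 0, -1; 0, 0, 1, 0, -2; 0, 0, 1, -1, 0],
      !![1, 0, -1, 0, 0; 0, 1, -1, 0, -1; 0, 0, -2, 1, 0; 0, 0, -2, 1, -1; 0, 0, -1, 0, 0],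
      by decide +kernel, by decide +kernel, by decide +kernel⟩
  · rw [show Matrix.mulVec _ ![1, 0] ⬝ᵥ Matrix.mulVec _ ![1, 0] = (2 : ℤ) by decide +kernel] at heq
    obtain rfl : s = 2 := by omega
    obtain rfl : t = 4 := by omega
    exact h.congr
      ⟨!![1, 0, 0, -1, 0; 0, 1, 0, -1, 0; 0, 0, 0, 0, -1; 0, 0, 0, -1, 0; 0, 0, 1, -1, 0],
      !![1, 0, 0, -1, 0; 0, 1, 0, -1, 0; 0, 0, 0, -1, 1; 0, 0, 0, -1, 0; 0, 0, -1, 0, 0],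
      by decide +kernel, by decide +kernel, by decide +kernel⟩
  · rw [show Matrix.mulVec _ ![1, 1] ⬝ᵥ Matrix.mulVec _ ![1, 1] = (6 : ℤ) by decide +kernel] at heq
    obtain rfl : s = 4 := by omega
    obtain rfl : t = 4 := by omega
    exact h.congr
      ⟨!![1, 0, 1, -1, -1; 0, 0, 1, -1, -1; 0, 1, 1, -1, -1; 0, 0, 2, -1, -2; 0, 0, 1, -1, 0],
      !![1, -1, 0, 0, 0; 0, -1, 1, 0, 0; 0, -2, 0, 1, 1; 0, -2, 0, 1, 0; 0, -1, 0, 0, 1],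
      by decide +kernel, by decide +kernel, by decide +kernel⟩

theorem HasBlockDet.extend_D5 (hG : EvenUnimodularPos G)
    (h : HasBlockDet G 3 (leadingE8 5) 4) :
    HasBlockDet G 2 (leadingE8 6) 3 := by
  obtain ⟨a, s, t, ha0, ha, h, hs, ht0, ht, heq⟩ := h.exists_bordered_cyclic hG
    !![0; 0; 0; 0; -1]
    !![2, 1, 0, 2, 3]
    !![2, 1, 1, 2, 2; 2, 2, 1, 3, 3; 3, 2, 2, 4, 4; 4, 3, 2, 6, 6; 3, 2, 1, 4, 5]
    !![-2; -3; -4; -6; -5]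
    4 5 3
    (by decide +kernel) (by decide +kernel) (by decide +kernel) (by decide) (by decide) (by decide)
    (by norm_num [Nat.choose])
  have ha' : a ≤ 2 := by omega
  interval_cases a <;> norm_num at heq
  · omega
  · obtain rfl : s = 2 := by omega
    obtain rfl : t = 3 := by omega
    exact h.congr ⟨1, 1, by decide +kernel, by decide +kernel, by decide +kernel⟩
  · omega

theorem HasBlockDet.extend_E6 (hG : EvenUnimodularPos G)
    (h : HasBlockDet G 2 (leadingE8 6) 3) :
    HasBlockDet G 1 (leadingE8 7) 2 := by
  obtain ⟨a, s, t, ha0, ha, h, hs, ht0, ht, heq⟩ := h.exists_bordered_cyclic hG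
    !![0; 0; 0; 0; 0; -1]
    !![1, 0, 2, 0, 1, 2]
    !![2, 1, 3, 2, 2, 2; 2, 2, 4, 3, 3, 3; 3, 2, 6, 4, 4, 4; 4, 3, 8, 6, 6, 6; 3, 2, 6, 4, 5, 5;
      2, 1, 4, 2, 3, 4]
    !![-2; -3; -4; -6; -5; -4]
    3 4 2
    (by decide +kernel) (by decide +kernel) (by decide +kernel) (by decide) (by decide) (by decide)
    (by norm_num [Nat.choose])
  have ha' : a ≤ 1 := by omega
  interval_cases a <;> norm_num at heq
  · omega
  · obtain rfl : s = 2 := by omega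
    obtain rfl : t = 2 := by omega
    exact h.congr ⟨1, 1, by decide +kernel, by decide +kernel, by decide +kernel⟩

theorem HasBlockDet.extend_E7 (hG : EvenUnimodularPos G)
    (h : HasBlockDet G 1 (leadingE8 7) 2) :
    HasBlockDet G 0 (leadingE8 8) 1 := by
  obtain ⟨a, s, t, ha0, ha, h, hs, ht0, ht, heq⟩ := h.exists_bordered_cyclic hG
    !![0; 0; 0; 0; 0; 0; -1]
    !![0, 1, 0, 0, 1, 0, 1]
    !![2, 3, 3, 4, 4, 2, 2; 2, 5, 4, 6, 6, 3, 3; 3, 6, 6, 8, 8, 4, 4; 4, 9, 8, 12, 12, 6, 6;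
      3, 7, 6, 9, 10, 5, 5; 2, 5, 4, 6, 7, 4, 4; 1, 3, 2, 3, 4, 2, 3]
    !![-2; -3; -4; -6; -5; -4; -3]
    2 3 1
    (by decide +kernel) (by decide +kernel) (by decide +kernel) (by decide) (by decide) (by decide)
    (by norm_num [Nat.choose])
  have ha' : a ≤ 1 := by omega
  interval_cases a <;> norm_num at heq
  · omega
  · obtain rfl : s = 2 := by omega
    obtain rfl : t = 1 := by omega
    exact h.congr ⟨1, 1, by decide +kernel, by decide +kernel, by decide +kernel⟩

/-- Every positive definite even unimodular lattice of rank `8` has the Gram matrix `E8M`. -/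
theorem EvenUnimodularPos.gramCongr_E8M {G : Matrix (Fin 8) (Fin 8) ℤ}
    (hG : EvenUnimodularPos G) : GramCongr G E8M := by
  have h3 : HasBlockDet G 5 (leadingE8 3) 6 ∨ HasBlockDet G 5 gramA3 4 := by
    rcases hG.hasBlockDet_A1.extend_A1 hG with h | h
    · exact h.extend_A1A1 hG
    · exact Or.inr (h.extend_A2 hG)
  have h5 : HasBlockDet G 3 (leadingE8 5) 4 := by
    rcases h3 with h | h
    · exact (h.extend_A2A1 hG).extend_A4 hG
    · rcases h.extend_A3 hG with h | h
      · exact h.extend_A4 hG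
      · exact h.extend_D4 hG
  exact (((h5.extend_D5 hG).extend_E6 hG).extend_E7 hG).1.gramCongr

end RootLattices

/-- Every even, unimodular, negative definite lattice of rank 8 (given
here by a symmetric Gram matrix `G` on `ℤ⁸` with `det G = ±1`, all squares even and
`x·x < 0` for `x ≠ 0`) is isometric to `E₈(−1)`. -/
theorem even_unimodular_negDefinite_rank_eight_isometric_E8_neg
    (G : Matrix (Fin 8) (Fin 8) ℤ)
    (hsymm : G.transpose = G)
    (hunimod : G.det = 1 ∨ G.det = -1)
    (heven : ∀ x : Fin 8 → ℤ, Even (x ⬝ᵥ G.mulVec x))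
    (hneg : ∀ x : Fin 8 → ℤ, x ≠ 0 → x ⬝ᵥ G.mulVec x < 0) :
    ∃ e : (Fin 8 → ℤ) ≃ₗ[ℤ] (Fin 8 → ℤ), ∀ x y : Fin 8 → ℤ,
      x ⬝ᵥ G.mulVec y = (e x) ⬝ᵥ (-E8M).mulVec (e y) := by
  have hpos : GramPos (-G) := by
    intro x hx
    rw [Matrix.neg_mulVec, dotProduct_neg]
    exact neg_pos.mpr (hneg x hx)
  have hGsymm : (-G).IsSymm := by
    rw [Matrix.IsSymm, Matrix.transpose_neg, hsymm]
  have hdet : (-G).det = 1 := by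
    obtain ⟨T, i, hT, hle⟩ := exists_congr_hermite 7 (-G) hGsymm hpos
    have hTi := (hT.pos hpos).apply_self i
    have hdet_pos : 0 < (-G).det :=
      pos_of_mul_pos_right (lt_of_lt_of_le (by positivity) hle) (by positivity)
    rw [Matrix.det_neg] at hdet_pos ⊢
    rcases hunimod with h | h <;> simp [h] at hdet_pos ⊢
  have hG : EvenUnimodularPos (-G) := by
    refine ⟨hGsymm, hpos, fun x => ?_, hdet⟩
    rw [Matrix.neg_mulVec, dotProduct_neg]
    exact (heven x).neg
  obtain ⟨U, V, hUV, hVU, hE⟩ := hG.gramCongr_E8M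
  refine ⟨Matrix.toLin'OfInv hUV hVU, fun x y => ?_⟩
  change x ⬝ᵥ G.mulVec y = V.mulVec x ⬝ᵥ (-E8M).mulVec (V.mulVec y)
  rw [← dotProduct_congr_mulVec]
  have hG' : V.transpose * -E8M * V = G := by
    rw [← hE, Matrix.mul_neg, Matrix.neg_mul, neg_eq_iff_eq_neg, Matrix.mul_assoc, Matrix.mul_assoc,
      hUV, Matrix.mul_one, ← Matrix.mul_assoc, ← Matrix.transpose_mul, hUV, Matrix.transpose_one,
      Matrix.one_mul]
  rw [hG']
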